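/- Under Assumptions 1 and 2, for every ū ∈ int(ΘD) there exist an open neighborhood U of ū and compact sets C₁, C₂ ⊆ ℝ^q such that for every u ∈ U: the sets X*(u) and Y*(u) are nonempty, X*(u) ⊆ C₁, and y ∈ C₂ for every (w, y) ∈ Y*(u). -/

import Mathlib

open Matrix Set Topology Filter

noncomputable section

variable {q m r : ℕ}

/-- The dual cone `K* = {y : ⟨y,x⟩ ≥ 0 for all x ∈ K}`. -/
def dualCone (K : Set (Fin q → ℝ)) : Set (Fin q → ℝ) :=
  {y | ∀ x ∈ K, 0 ≤ y ⬝ᵥ x}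

/-- `K` is a pointed, closed, convex cone with nonempty interior. -/
def ConeAssumptions (K : Set (Fin q → ℝ)) : Prop :=
  IsClosed K ∧ Convex ℝ K ∧ (∀ x ∈ K, ∀ t : ℝ, 0 < t → t • x ∈ K) ∧
    (∀ x ∈ K, x ≠ 0 → -x ∉ K) ∧ (interior K).Nonempty

/-- The mpKKT system for parameters `(u,v)` with data `(x,w,y)`. -/
def mpKKT (K : Set (Fin q → ℝ)) (A : Matrix (Fin m) (Fin q) ℝ)
    (M : Matrix (Fin r) (Fin q) ℝ) (b : Fin m → ℝ) (c d : Fin q → ℝ)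
    (u v : Fin r → ℝ) (x : Fin q → ℝ) (w : Fin m → ℝ) (y : Fin q → ℝ) : Prop :=
  A.mulVec x = b ∧ M.mulVec x = M.mulVec d + v ∧ x ∈ K ∧
    Aᵀ.mulVec w + y = c + Mᵀ.mulVec u ∧ y ∈ dualCone K ∧ x ⬝ᵥ y = 0

/-- The set-valued map `Φ`. -/
def Phi (K : Set (Fin q → ℝ)) (A : Matrix (Fin m) (Fin q) ℝ)
    (M : Matrix (Fin r) (Fin q) ℝ) (b : Fin m → ℝ) (c d : Fin q → ℝ)
    (u : Fin r → ℝ) : Set (Fin r → ℝ) :=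
  {v | ∃ x w y, mpKKT K A M b c d u v x w y}

/-- The set-valued map `Ψ`. -/
def Psi (K : Set (Fin q → ℝ)) (A : Matrix (Fin m) (Fin q) ℝ)
    (M : Matrix (Fin r) (Fin q) ℝ) (b : Fin m → ℝ) (c d : Fin q → ℝ)
    (v : Fin r → ℝ) : Set (Fin r → ℝ) :=
  {u | ∃ x w y, mpKKT K A M b c d u v x w y}

/-- The primal conic representable set `ΘP`. -/
def ThetaP (K : Set (Fin q → ℝ)) (A : Matrix (Fin m) (Fin q) ℝ)
    (M : Matrix (Fin r) (Fin q) ℝ) (b : Fin m → ℝ) (d : Fin q → ℝ) :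
    Set (Fin r → ℝ) :=
  {v | ∃ x ∈ K, A.mulVec x = b ∧ M.mulVec x = M.mulVec d + v}

/-- The dual conic representable set `ΘD`. -/
def ThetaD (K : Set (Fin q → ℝ)) (A : Matrix (Fin m) (Fin q) ℝ)
    (M : Matrix (Fin r) (Fin q) ℝ) (c : Fin q → ℝ) : Set (Fin r → ℝ) :=
  {u | ∃ w : Fin m → ℝ, ∃ y ∈ dualCone K, Aᵀ.mulVec w + y = c + Mᵀ.mulVec u}

/-- Assumption 1: full row rank and trivially intersecting row spaces. -/
def Assumption1 (A : Matrix (Fin m) (Fin q) ℝ) (M : Matrix (Fin r) (Fin q) ℝ) : Prop :=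
  LinearIndependent ℝ A ∧ LinearIndependent ℝ M ∧
    Submodule.span ℝ (Set.range A) ⊓ Submodule.span ℝ (Set.range M) = ⊥

/-- Assumption 2 (Slater condition). -/
def Assumption2 (K : Set (Fin q → ℝ)) (A : Matrix (Fin m) (Fin q) ℝ)
    (M : Matrix (Fin r) (Fin q) ℝ) (b : Fin m → ℝ) (c : Fin q → ℝ) : Prop :=
  (∃ x ∈ interior K, A.mulVec x = b) ∧
    ∃ (w : Fin m → ℝ) (s : Fin r → ℝ),
      c - Aᵀ.mulVec w - Mᵀ.mulVec s ∈ interior (dualCone K)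

/-- A basic semialgebraic set: finitely many polynomial equalities and strict inequalities. -/
def IsBasicSemialgebraic {ι : Type} [Fintype ι] (S : Set (ι → ℝ)) : Prop :=
  ∃ (k l : ℕ) (f : Fin k → MvPolynomial ι ℝ) (g : Fin l → MvPolynomial ι ℝ),
    S = {x | (∀ i, MvPolynomial.eval x (f i) = 0) ∧ ∀ j, 0 < MvPolynomial.eval x (g j)}

/-- A semialgebraic set: a finite union of basic semialgebraic sets. -/
def IsSemialgebraic {ι : Type} [Fintype ι] (S : Set (ι → ℝ)) : Prop :=
  ∃ (N : ℕ) (T : Fin N → Set (ι → ℝ)), (∀ i, IsBasicSemialgebraic (T i)) ∧ S = ⋃ i, T i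

/-- A linearity set of `ΘP`. -/
def IsLinearitySet (K : Set (Fin q → ℝ)) (A : Matrix (Fin m) (Fin q) ℝ)
    (M : Matrix (Fin r) (Fin q) ℝ) (b : Fin m → ℝ) (c d : Fin q → ℝ)
    (V : Set (Fin r → ℝ)) : Prop :=
  V ⊆ ThetaP K A M b d ∧ IsPathConnected V ∧
    (∀ v₁ ∈ V, ∀ v₂ ∈ V, Psi K A M b c d v₁ = Psi K A M b c d v₂) ∧
    (∀ v ∈ V, (Psi K A M b c d v).Nonempty) ∧
    (∃ v ∈ V, ∃ u ∈ Psi K A M b c d v, ∃ v' : Fin r → ℝ, v' ≠ v ∧ u ∈ Psi K A M b c d v') ∧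
    ∀ G : Set (Fin r → ℝ), G ⊆ ThetaP K A M b d → IsPathConnected G → V ⊂ G →
      ¬((∀ v₁ ∈ G, ∀ v₂ ∈ G, Psi K A M b c d v₁ = Psi K A M b c d v₂) ∧
        ∀ v ∈ G, (Psi K A M b c d v).Nonempty)

/-- A nonlinearity set of `ΘP`: a maximal path-connected open subset of `ΘP`
disjoint from every linearity set. -/
def IsNonlinearitySet (K : Set (Fin q → ℝ)) (A : Matrix (Fin m) (Fin q) ℝ)
    (M : Matrix (Fin r) (Fin q) ℝ) (b : Fin m → ℝ) (c d : Fin q → ℝ)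
    (V : Set (Fin r → ℝ)) : Prop :=
  V ⊆ ThetaP K A M b d ∧ IsPathConnected V ∧ IsOpen V ∧
    (∀ L, IsLinearitySet K A M b c d L → Disjoint V L) ∧
    ∀ G : Set (Fin r → ℝ), G ⊆ ThetaP K A M b d → IsPathConnected G → IsOpen G →
      (∀ L, IsLinearitySet K A M b c d L → Disjoint G L) → V ⊆ G → G = V

/-- The set of optimal solutions of the primal problem with objective `⟨c + Mᵀu, ·⟩`. -/
def Xstar (K : Set (Fin q → ℝ)) (A : Matrix (Fin m) (Fin q) ℝ)
    (M : Matrix (Fin r) (Fin q) ℝ) (b : Fin m → ℝ) (c : Fin q → ℝ)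
    (u : Fin r → ℝ) : Set (Fin q → ℝ) :=
  {x | x ∈ K ∧ A.mulVec x = b ∧
    ∀ x' ∈ K, A.mulVec x' = b → (c + Mᵀ.mulVec u) ⬝ᵥ x ≤ (c + Mᵀ.mulVec u) ⬝ᵥ x'}

/-- The set of optimal solutions `(w,y)` of the dual problem. -/
def Ystar (K : Set (Fin q → ℝ)) (A : Matrix (Fin m) (Fin q) ℝ)
    (M : Matrix (Fin r) (Fin q) ℝ) (b : Fin m → ℝ) (c : Fin q → ℝ)
    (u : Fin r → ℝ) : Set ((Fin m → ℝ) × (Fin q → ℝ)) :=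
  {p | Aᵀ.mulVec p.1 + p.2 = c + Mᵀ.mulVec u ∧ p.2 ∈ dualCone K ∧
    ∀ (w' : Fin m → ℝ) (y' : Fin q → ℝ),
      Aᵀ.mulVec w' + y' = c + Mᵀ.mulVec u → y' ∈ dualCone K → b ⬝ᵥ w' ≤ b ⬝ᵥ p.1}

/-- The optimal value function of the primal problem (1). -/
def valP (K : Set (Fin q → ℝ)) (A : Matrix (Fin m) (Fin q) ℝ)
    (M : Matrix (Fin r) (Fin q) ℝ) (b : Fin m → ℝ) (c d : Fin q → ℝ)
    (v : Fin r → ℝ) : ℝ :=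
  sInf {z | ∃ x ∈ K, A.mulVec x = b ∧ M.mulVec x = M.mulVec d + v ∧ z = c ⬝ᵥ x}

theorem aux_interior (S : Set (Fin q → ℝ)) (p : Fin q → ℝ) (hp : p ∈ interior S) :
    ∃ ρ : ℝ, 0 < ρ ∧ ∀ᶠ p' in 𝓝 p, ∀ z : Fin q → ℝ, (∀ s ∈ S, 0 ≤ z ⬝ᵥ s) →
      ∀ i, ρ * |z i| ≤ z ⬝ᵥ p' := by
  rw [mem_interior_iff_mem_nhds, Metric.mem_nhds_iff] at hp
  obtain ⟨ε, hε, hb⟩ := hp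
  refine ⟨ε / 4, by positivity, ?_⟩
  filter_upwards [Metric.ball_mem_nhds p (show 0 < ε / 2 by positivity)] with p' hp' z hz i
  have key : ∀ t : ℝ, |t| ≤ ε / 4 → 0 ≤ z ⬝ᵥ p' + z i * t := by
    intro t ht
    have hm : p' + Pi.single i t ∈ S := by
      apply hb
      rw [Metric.mem_ball] at hp' ⊢
      have h1 : dist (p' + Pi.single i t) p' ≤ ε / 4 := by
        rw [dist_eq_norm, add_sub_cancel_left]
        refine (pi_norm_le_iff_of_nonneg (by positivity)).2 fun j => ?_
        by_cases hj : j = i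
        · subst hj; simpa using ht
        · simp [hj]; positivity
      have := dist_triangle (p' + Pi.single i t) p' p
      linarith
    have := hz _ hm
    rwa [dotProduct_add, dotProduct_single] at this
  have h1 := key (ε / 4) (by rw [abs_of_pos (by positivity)])
  have h2 := key (-(ε / 4)) (by rw [abs_neg, abs_of_pos (by positivity)])
  rcases abs_cases (z i) with ⟨h, _⟩ | ⟨h, _⟩ <;> rw [h] <;> linarith

theorem aux_box (p z : Fin q → ℝ) (ρ B : ℝ) (hρ : 0 < ρ)
    (h : ∀ i, ρ * |z i| ≤ z ⬝ᵥ p) (hB : z ⬝ᵥ p ≤ B) :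
    z ∈ Set.Icc (fun _ : Fin q => -(B / ρ)) (fun _ => B / ρ) := by
  have : ∀ i, |z i| ≤ B / ρ := fun i => by
    rw [le_div_iff₀ hρ]; linarith [h i]
  exact ⟨fun i => (abs_le.1 (this i)).1, fun i => (abs_le.1 (this i)).2⟩

theorem aux_min (F : Set (Fin q → ℝ)) (hF : IsClosed F) (p : Fin q → ℝ) (ρ : ℝ) (hρ : 0 < ρ)
    (h : ∀ z ∈ F, ∀ i, ρ * |z i| ≤ z ⬝ᵥ p) (hne : F.Nonempty) :
    ∃ z ∈ F, ∀ z' ∈ F, z ⬝ᵥ p ≤ z' ⬝ᵥ p := by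
  obtain ⟨z0, hz0⟩ := hne
  have hc : Continuous fun z : Fin q → ℝ => z ⬝ᵥ p := by fun_prop
  have hcl : IsClosed (F ∩ {z | z ⬝ᵥ p ≤ z0 ⬝ᵥ p}) :=
    hF.inter (isClosed_le hc continuous_const)
  have hcomp : IsCompact (F ∩ {z | z ⬝ᵥ p ≤ z0 ⬝ᵥ p}) :=
    isCompact_Icc.of_isClosed_subset hcl
      (fun z hz => aux_box p z ρ (z0 ⬝ᵥ p) hρ (h z hz.1) hz.2)
  obtain ⟨z, hz, hmin⟩ := hcomp.exists_isMinOn ⟨z0, hz0, le_refl (z0 ⬝ᵥ p)⟩ hc.continuousOn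
  refine ⟨z, hz.1, fun z' hz' => ?_⟩
  by_cases hle : z' ⬝ᵥ p ≤ z0 ⬝ᵥ p
  · exact hmin ⟨hz', hle⟩
  · have : z ⬝ᵥ p ≤ z0 ⬝ᵥ p := hz.2
    linarith

theorem aux_dual_closed (K : Set (Fin q → ℝ)) : IsClosed (dualCone K) := by
  have : dualCone K = ⋂ x ∈ K, {y | 0 ≤ y ⬝ᵥ x} := by ext; simp [dualCone]
  rw [this]
  exact isClosed_biInter fun x _ => isClosed_le continuous_const (by fun_prop)

theorem aux_dual_convex (K : Set (Fin q → ℝ)) : Convex ℝ (dualCone K) := by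
  intro y hy z hz s t hs ht _ x hx
  rw [add_dotProduct, smul_dotProduct, smul_dotProduct]
  have := mul_nonneg hs (hy x hx)
  have := mul_nonneg ht (hz x hx)
  simp only [smul_eq_mul]; linarith

theorem aux_tr (A : Matrix (Fin m) (Fin q) ℝ) (w : Fin m → ℝ) (x : Fin q → ℝ) :
    (Aᵀ.mulVec w) ⬝ᵥ x = w ⬝ᵥ A.mulVec x := by
  rw [Matrix.mulVec_transpose, Matrix.dotProduct_mulVec]

/-- strict dual feasibility at interior points -/
theorem aux_strict (K : Set (Fin q → ℝ)) 
    (A : Matrix (Fin m) (Fin q) ℝ) (M : Matrix (Fin r) (Fin q) ℝ) (c : Fin q → ℝ)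
    (h : ∃ (w : Fin m → ℝ) (s : Fin r → ℝ),
      c - Aᵀ.mulVec w - Mᵀ.mulVec s ∈ interior (dualCone K))
    (ubar : Fin r → ℝ) (hu : ubar ∈ interior (ThetaD K A M c)) :
    ∃ w, c + Mᵀ.mulVec ubar - Aᵀ.mulVec w ∈ interior (dualCone K) := by
  obtain ⟨w0, s0, h0⟩ := h
  have hc : Continuous fun t : ℝ => ubar + t • (ubar + s0) := by fun_prop
  have hev : ∀ᶠ t in 𝓝 (0 : ℝ), ubar + t • (ubar + s0) ∈ ThetaD K A M c := by
    apply hc.continuousAt.eventually_mem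
    simpa using mem_interior_iff_mem_nhds.1 hu
  obtain ⟨ε, hε, hb⟩ := Metric.eventually_nhds_iff.1 hev
  have ht : 0 < ε / 2 := by positivity
  obtain ⟨w1, y1, hy1, h1⟩ := hb (y := ε / 2) (by simp [abs_of_pos hε]; linarith)
  set t := ε / 2
  have hcomb := (aux_dual_convex K).combo_interior_self_mem_interior h0 hy1
    (a := t / (1 + t)) (b := 1 / (1 + t)) (by positivity) (by positivity)
    (by field_simp; ring)
  refine ⟨(t / (1 + t)) • w0 + (1 / (1 + t)) • w1, ?_⟩
  convert hcomb using 1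
  have hy : y1 = c + Mᵀ.mulVec (ubar + t • (ubar + s0)) - Aᵀ.mulVec w1 := by
    rw [← h1]; abel
  rw [hy]
  simp only [Matrix.mulVec_add, Matrix.mulVec_smul]
  ext i
  simp only [Pi.add_apply, Pi.sub_apply, Pi.smul_apply, smul_eq_mul]
  field_simp
  ring

/-- local nonemptiness and uniform boundedness of optimal solution sets. -/
theorem stmt_9 (hq : 0 < q) (hm : 0 < m) (hr : 0 < r) (hmr : m + r ≤ q)
    (K : Set (Fin q → ℝ)) (hK : ConeAssumptions K)
    (A : Matrix (Fin m) (Fin q) ℝ) (M : Matrix (Fin r) (Fin q) ℝ)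
    (b : Fin m → ℝ) (c d : Fin q → ℝ)
    (hA1 : Assumption1 A M) (hA2 : Assumption2 K A M b c) :
    ∀ ubar ∈ interior (ThetaD K A M c),
      ∃ U : Set (Fin r → ℝ), IsOpen U ∧ ubar ∈ U ∧
        ∃ C₁ C₂ : Set (Fin q → ℝ), IsCompact C₁ ∧ IsCompact C₂ ∧
          ∀ u ∈ U, (Xstar K A M b c u).Nonempty ∧ (Ystar K A M b c u).Nonempty ∧
            Xstar K A M b c u ⊆ C₁ ∧ ∀ p ∈ Ystar K A M b c u, p.2 ∈ C₂ := by
  intro ubar hu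
  obtain ⟨hKc, -, -, -, -⟩ := hK
  obtain ⟨⟨xh, hxh, hxb⟩, hsl⟩ := hA2
  obtain ⟨wb, hwb⟩ := aux_strict K A M c hsl ubar hu
  obtain ⟨ρ₁, hρ₁, hev₁⟩ := aux_interior _ _ hwb
  obtain ⟨ρ₂, hρ₂, hev₂⟩ := aux_interior _ _ hxh
  have hev₂ := hev₂.self_of_nhds
  have hcont : Continuous fun u : Fin r → ℝ => c + Mᵀ.mulVec u - Aᵀ.mulVec wb := by fun_prop
  have e1 := (hcont.continuousAt (x := ubar)).eventually hev₁
  have e2 : ∀ᶠ u in 𝓝 ubar, c + Mᵀ.mulVec u - Aᵀ.mulVec wb ∈ dualCone K :=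
    hcont.continuousAt.eventually_mem (mem_interior_iff_mem_nhds.1 hwb)
  have hcont2 : Continuous fun u : Fin r → ℝ => (c + Mᵀ.mulVec u - Aᵀ.mulVec wb) ⬝ᵥ xh := by
    fun_prop
  obtain ⟨B, hB⟩ : ∃ B, (c + Mᵀ.mulVec ubar - Aᵀ.mulVec wb) ⬝ᵥ xh < B := exists_gt _
  have e3 : ∀ᶠ u in 𝓝 ubar, (c + Mᵀ.mulVec u - Aᵀ.mulVec wb) ⬝ᵥ xh < B :=
    hcont2.continuousAt.eventually_lt continuousAt_const hB
  obtain ⟨U, hU, hUo, hUm⟩ := eventually_nhds_iff.1 (e1.and (e2.and e3))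
  refine ⟨U, hUo, hUm, Set.Icc (fun _ => -(B / ρ₁)) (fun _ => B / ρ₁),
    Set.Icc (fun _ => -(B / ρ₂)) (fun _ => B / ρ₂), isCompact_Icc, isCompact_Icc, ?_⟩
  intro u huU
  obtain ⟨f1, f2, f3⟩ := hU u huU
  have hxK : xh ∈ K := interior_subset hxh
  have hprim : ∀ x ∈ K, ∀ s ∈ dualCone K, 0 ≤ x ⬝ᵥ s := fun x hx s hs => by
    rw [dotProduct_comm]; exact hs x hx
  have obj : ∀ x, A.mulVec x = b → (c + Mᵀ.mulVec u) ⬝ᵥ x =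
      x ⬝ᵥ (c + Mᵀ.mulVec u - Aᵀ.mulVec wb) + wb ⬝ᵥ b := by
    intro x hx
    rw [dotProduct_comm x, sub_dotProduct, aux_tr, hx]; ring
  have dobj : ∀ w y, Aᵀ.mulVec w + y = c + Mᵀ.mulVec u →
      y ⬝ᵥ xh = (c + Mᵀ.mulVec u) ⬝ᵥ xh - b ⬝ᵥ w := by
    intro w y h
    rw [← h, add_dotProduct, aux_tr, hxb, dotProduct_comm w b]; ring
  refine ⟨?_, ?_, ?_, ?_⟩
  · have hcl : IsClosed {x | x ∈ K ∧ A.mulVec x = b} :=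
      hKc.inter (isClosed_eq (by fun_prop) continuous_const)
    obtain ⟨x, ⟨hx, hxA⟩, hmin⟩ := aux_min _ hcl (c + Mᵀ.mulVec u - Aᵀ.mulVec wb) ρ₁ hρ₁
      (fun z hz => f1 z (hprim z hz.1)) ⟨xh, hxK, hxb⟩
    refine ⟨x, hx, hxA, fun x' hx' hx'A => ?_⟩
    rw [obj x hxA, obj x' hx'A]
    linarith [hmin x' ⟨hx', hx'A⟩]
  · have hcl : IsClosed {y | y ∈ dualCone K ∧
        c + Mᵀ.mulVec u - y ∈ LinearMap.range Aᵀ.mulVecLin} := by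
      refine (aux_dual_closed K).inter ?_
      exact (Submodule.closed_of_finiteDimensional (LinearMap.range Aᵀ.mulVecLin)).preimage
        (f := fun y => c + Mᵀ.mulVec u - y) (by fun_prop)
    obtain ⟨y, ⟨hy, ⟨w, hw⟩⟩, hmin⟩ := aux_min _ hcl xh ρ₂ hρ₂ (fun z hz => hev₂ z hz.1)
      ⟨c + Mᵀ.mulVec u - Aᵀ.mulVec wb, f2, wb, by rw [Matrix.mulVecLin_apply]; abel⟩
    have hwy : Aᵀ.mulVec w + y = c + Mᵀ.mulVec u := by
      rw [Matrix.mulVecLin_apply] at hw; rw [hw]; abel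
    refine ⟨(w, y), hwy, hy, fun w' y' h' hy' => ?_⟩
    have := hmin y' ⟨hy', w', by rw [Matrix.mulVecLin_apply, ← h']; abel⟩
    rw [dobj w y hwy, dobj w' y' h'] at this
    show b ⬝ᵥ w' ≤ b ⬝ᵥ w
    linarith
  · rintro x ⟨hx, hxA, hmin⟩
    refine aux_box _ x ρ₁ B hρ₁ (f1 x (hprim x hx)) ?_
    have := hmin xh hxK hxb
    rw [obj x hxA, obj xh hxb, dotProduct_comm xh] at this
    linarith
  · rintro ⟨w, y⟩ ⟨hwy, hy, hmax⟩
    refine aux_box xh y ρ₂ B hρ₂ (hev₂ y hy) ?_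
    have hf : Aᵀ.mulVec wb + (c + Mᵀ.mulVec u - Aᵀ.mulVec wb) = c + Mᵀ.mulVec u := by abel
    have h1 := hmax wb _ hf f2
    have h2 := dobj wb _ hf
    have h3 := dobj w y hwy
    simp only at h1
    linarith
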